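/- A probability mass function p on the nonnegative integers is infinitely divisible with integer-valued components if and only if it is a Poisson compound of a nonnegative integer valued random variable: there exist λ ≥ 0 and a probability mass function r on the nonnegative integers such that p(m) = e^{−λ} ∑_{k=0}^{∞} (λ^k / k!) r^{*k}(m) for every nonnegative integer m, where r^{*k} denotes the k-fold convolution of r (with r^{*0} the point mass at 0). -/

import Mathlib

/-- `p` is a probability mass function on the nonnegative integers. -/
def IsPMF (p : ℕ → ℝ) : Prop := (∀ n, 0 ≤ p n) ∧ HasSum p 1

/-- Convolution of two mass functions on ℕ. -/
def conv (q r : ℕ → ℝ) : ℕ → ℝ := fun m => ∑ j ∈ Finset.range (m + 1), q j * r (m - j)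

/-- n-fold convolution of `q` (with `nconv q 0` the point mass at 0). -/
def nconv (q : ℕ → ℝ) : ℕ → ℕ → ℝ
  | 0 => fun m => if m = 0 then 1 else 0
  | n + 1 => conv q (nconv q n)

open PowerSeries Filter Topology

lemma conv_eq_coeff (q r : ℕ → ℝ) (m : ℕ) :
    conv q r m = coeff m (PowerSeries.mk q * PowerSeries.mk r) := by
  simp [conv, coeff_mul, Finset.Nat.sum_antidiagonal_eq_sum_range_succ_mk]

lemma mk_nconv (q : ℕ → ℝ) (n : ℕ) :
    PowerSeries.mk (nconv q n) = PowerSeries.mk q ^ n := by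
  induction n with
  | zero => ext m; simp [nconv, coeff_one]
  | succ n ih =>
    ext m
    rw [coeff_mk, nconv, conv_eq_coeff, ih, pow_succ']

lemma nconv_eq_coeff (q : ℕ → ℝ) (n m : ℕ) :
    nconv q n m = coeff m (PowerSeries.mk q ^ n) := by
  rw [← mk_nconv, coeff_mk]

lemma nconv_nonneg {q : ℕ → ℝ} (hq : ∀ j, 0 ≤ q j) (n m : ℕ) : 0 ≤ nconv q n m := by
  induction n generalizing m with
  | zero => simp only [nconv]; split_ifs <;> norm_num
  | succ n ih =>
    simp only [nconv, conv]
    exact Finset.sum_nonneg fun j _ => mul_nonneg (hq j) (ih (m - j))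

lemma nconv_const_mul (c : ℝ) (q : ℕ → ℝ) (n m : ℕ) :
    nconv (fun j => c * q j) n m = c ^ n * nconv q n m := by
  have h : PowerSeries.mk (fun j => c * q j) = C c * PowerSeries.mk q := by ext j; simp
  rw [nconv_eq_coeff, nconv_eq_coeff, h, mul_pow, ← map_pow, coeff_C_mul]

lemma hasSum_conv {q r : ℕ → ℝ} {a b : ℝ} (hq : ∀ j, 0 ≤ q j) (hr : ∀ j, 0 ≤ r j)
    (ha : HasSum q a) (hb : HasSum r b) : HasSum (conv q r) (a * b) := by
  have hqn : Summable fun j => ‖q j‖ := by simpa [abs_of_nonneg, hq] using ha.summable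
  have hrn : Summable fun j => ‖r j‖ := by simpa [abs_of_nonneg, hr] using hb.summable
  have h := tsum_mul_tsum_eq_tsum_sum_range_of_summable_norm hqn hrn
  rw [ha.tsum_eq, hb.tsum_eq] at h
  rw [h]
  exact (summable_norm_sum_mul_range_of_summable_norm hqn hrn).of_norm.hasSum

lemma hasSum_nconv {q : ℕ → ℝ} {a : ℝ} (hq : ∀ j, 0 ≤ q j) (ha : HasSum q a) (n : ℕ) :
    HasSum (nconv q n) (a ^ n) := by
  induction n with
  | zero => simpa [nconv] using hasSum_ite_eq (0 : ℕ) (1 : ℝ)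
  | succ n ih => simpa [nconv, pow_succ'] using hasSum_conv hq (nconv_nonneg hq n) ha ih

lemma hasSum_pow_div_factorial (a : ℝ) :
    HasSum (fun k : ℕ => a ^ k / (k.factorial : ℝ)) (Real.exp a) := by
  rw [Real.exp_eq_exp_ℝ]
  exact NormedSpace.expSeries_div_hasSum_exp a

/-- The double series of a compound Poisson law, with its total mass. -/
lemma hasSum_exp_nconv {q : ℕ → ℝ} {a : ℝ} (hq : ∀ j, 0 ≤ q j) (ha : HasSum q a) {l : ℝ}
    (hl : 0 ≤ l) :
    HasSum (fun x : ℕ × ℕ => l ^ x.1 / (x.1.factorial : ℝ) * nconv q x.1 x.2)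
      (Real.exp (l * a)) := by
  have hf : ∀ k, HasSum (fun m => l ^ k / (k.factorial : ℝ) * nconv q k m)
      ((l * a) ^ k / (k.factorial : ℝ)) := fun k => by
    have := (hasSum_nconv hq ha k).mul_left (l ^ k / (k.factorial : ℝ))
    rwa [mul_pow, mul_div_right_comm]
  have hs : Summable (fun x : ℕ × ℕ => l ^ x.1 / (x.1.factorial : ℝ) * nconv q x.1 x.2) := by
    rw [summable_prod_of_nonneg fun x => mul_nonneg (by positivity) (nconv_nonneg hq _ _)]
    refine ⟨fun k => (hf k).summable, ?_⟩
    simpa [(hf _).tsum_eq] using (hasSum_pow_div_factorial (l * a)).summable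
  have := hs.hasSum.prod_fiberwise hf
  rw [← this.unique (hasSum_pow_div_factorial (l * a))]
  exact hs.hasSum

/-- The compound Poisson mass function with intensity `l` and jump law `r`. -/
noncomputable def compoundPoisson (r : ℕ → ℝ) (l : ℝ) (m : ℕ) : ℝ :=
  ∑' k : ℕ, Real.exp (-l) * (l ^ k / (k.factorial : ℝ)) * nconv r k m

lemma summable_compoundPoisson {r : ℕ → ℝ} (hr : IsPMF r) {l : ℝ} (hl : 0 ≤ l) (m : ℕ) :
    Summable fun k : ℕ => Real.exp (-l) * (l ^ k / (k.factorial : ℝ)) * nconv r k m := by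
  have h := (hasSum_exp_nconv hr.1 hr.2 hl).summable.prod_symm.prod_factor m
  simpa [mul_assoc] using h.mul_left (Real.exp (-l))

lemma isPMF_compoundPoisson {r : ℕ → ℝ} (hr : IsPMF r) {l : ℝ} (hl : 0 ≤ l) :
    IsPMF (compoundPoisson r l) := by
  refine ⟨fun m => tsum_nonneg fun k => mul_nonneg (by positivity) (nconv_nonneg hr.1 _ _), ?_⟩
  have h := ((hasSum_exp_nconv hr.1 hr.2 hl).mul_left (Real.exp (-l)))
  rw [mul_one, ← Real.exp_add, neg_add_cancel, Real.exp_zero] at h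
  simp only [← mul_assoc] at h
  rw [← (Equiv.prodComm ℕ ℕ).hasSum_iff] at h
  exact h.prod_fiberwise fun m => (summable_compoundPoisson hr hl m).hasSum

lemma compoundPoisson_zero (r : ℕ → ℝ) : compoundPoisson r 0 = nconv r 0 := by
  ext m
  rw [compoundPoisson, tsum_eq_single 0]
  · simp
  · intro k hk; simp [hk]

lemma sum_antidiagonal_exp_nconv (r : ℕ → ℝ) (a b : ℝ) (m k : ℕ) :
    ∑ x ∈ Finset.HasAntidiagonal.antidiagonal m, ∑ y ∈ Finset.HasAntidiagonal.antidiagonal k,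
      (Real.exp (-a) * (a ^ y.1 / (y.1.factorial : ℝ)) * nconv r y.1 x.1) *
        (Real.exp (-b) * (b ^ y.2 / (y.2.factorial : ℝ)) * nconv r y.2 x.2) =
      Real.exp (-(a + b)) * ((a + b) ^ k / (k.factorial : ℝ)) * nconv r k m := by
  rw [Finset.sum_comm, neg_add, Real.exp_add, (Commute.all a b).add_pow', Finset.sum_div,
    Finset.mul_sum, Finset.sum_mul]
  refine Finset.sum_congr rfl fun y hy => ?_
  obtain rfl := Finset.HasAntidiagonal.mem_antidiagonal.1 hy
  rw [nconv_eq_coeff r (y.1 + y.2), pow_add, coeff_mul, Finset.mul_sum]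
  refine Finset.sum_congr rfl fun x _ => ?_
  have h : ((y.1 + y.2).factorial : ℝ) ≠ 0 := Nat.cast_ne_zero.2 (Nat.factorial_ne_zero _)
  rw [← nconv_eq_coeff, ← nconv_eq_coeff, nsmul_eq_mul, Nat.cast_add_choose]
  field_simp

lemma sum_tsum_mul_tsum_eq_tsum_sum_antidiagonal {ι : Type*} (s : Finset ι) (f g : ι → ℕ → ℝ)
    (hf : ∀ i, Summable (f i)) (hg : ∀ i, Summable (g i)) :
    ∑ i ∈ s, (∑' k, f i k) * (∑' k, g i k) =
      ∑' k, ∑ i ∈ s, ∑ y ∈ Finset.HasAntidiagonal.antidiagonal k, f i y.1 * g i y.2 := by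
  rw [Summable.tsum_finsetSum fun i _ => (summable_norm_sum_mul_antidiagonal_of_summable_norm
    (f := f i) (g := g i) (hf i).norm (hg i).norm).of_norm]
  exact Finset.sum_congr rfl fun i _ =>
    tsum_mul_tsum_eq_tsum_sum_antidiagonal_of_summable_norm (hf i).norm (hg i).norm

lemma conv_compoundPoisson {r : ℕ → ℝ} (hr : IsPMF r) {a b : ℝ} (ha : 0 ≤ a) (hb : 0 ≤ b) :
    conv (compoundPoisson r a) (compoundPoisson r b) = compoundPoisson r (a + b) := by
  ext m
  rw [conv_eq_coeff, coeff_mul]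
  simp only [coeff_mk]
  refine (sum_tsum_mul_tsum_eq_tsum_sum_antidiagonal (Finset.HasAntidiagonal.antidiagonal m)
    (fun x k => Real.exp (-a) * (a ^ k / (k.factorial : ℝ)) * nconv r k x.1)
    (fun x k => Real.exp (-b) * (b ^ k / (k.factorial : ℝ)) * nconv r k x.2)
    (fun x => summable_compoundPoisson hr ha x.1)
    (fun x => summable_compoundPoisson hr hb x.2)).trans ?_
  exact tsum_congr fun k => sum_antidiagonal_exp_nconv r a b m k

lemma nconv_compoundPoisson {r : ℕ → ℝ} (hr : IsPMF r) {a : ℝ} (ha : 0 ≤ a) (n : ℕ) :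
    nconv (compoundPoisson r a) n = compoundPoisson r (n * a) := by
  induction n with
  | zero => simp [compoundPoisson_zero, nconv]
  | succ n ih =>
    rw [nconv, ih, conv_compoundPoisson hr ha (by positivity)]
    push_cast
    ring_nf

lemma nconv_zero_right (q : ℕ → ℝ) (n : ℕ) : nconv q n 0 = q 0 ^ n := by
  simp [nconv_eq_coeff]

lemma nconv_eq_zero_of_lt {q : ℕ → ℝ} (h0 : q 0 = 0) {n m : ℕ} (h : m < n) :
    nconv q n m = 0 := by
  rw [nconv_eq_coeff]
  refine X_pow_dvd_iff.1 (pow_dvd_pow_of_dvd (X_dvd_iff.2 ?_) n) m h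
  simpa using h0

/-- An infinitely divisible mass function charges the origin. -/
lemma pos_zero_of_infinitelyDivisible {p : ℕ → ℝ} (hp : IsPMF p)
    (h : ∀ n : ℕ, 1 ≤ n → ∃ q : ℕ → ℝ, IsPMF q ∧ nconv q n = p) : 0 < p 0 := by
  refine lt_of_le_of_ne (hp.1 0) fun h0 => ?_
  have hz : p = 0 := by
    ext m
    obtain ⟨q, -, hq⟩ := h (m + 1) (by omega)
    have hq0 : q 0 = 0 := by
      rw [← hq, nconv_zero_right] at h0
      exact eq_zero_of_pow_eq_zero h0.symm
    rw [← hq, nconv_eq_zero_of_lt hq0 (Nat.lt_succ_self m)]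
    rfl
  exact zero_ne_one ((hz ▸ hasSum_zero : HasSum p 0).unique hp.2)

lemma IsPMF.le_one_sub {q : ℕ → ℝ} (hq : IsPMF q) {j : ℕ} (hj : j ≠ 0) : q j ≤ 1 - q 0 := by
  have := sum_le_hasSum {0, j} (fun i _ => hq.1 i) hq.2
  rw [Finset.sum_pair hj.symm] at this
  linarith

/-- The logarithmic derivative of the generating function of an infinitely divisible mass
function has nonnegative coefficients. -/
lemma coeff_logDeriv_nonneg {p : ℕ → ℝ} (h0 : 0 < p 0)
    (h : ∀ n : ℕ, 1 ≤ n → ∃ q : ℕ → ℝ, IsPMF q ∧ nconv q n = p) {L : ℝ⟦X⟧}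
    (hL : L * PowerSeries.mk p = derivative ℝ (PowerSeries.mk p)) (m : ℕ) :
    0 ≤ coeff m L := by
  choose q hq hqp using fun n : ℕ => h (n + 1) (by omega)
  have hpow : ∀ n, PowerSeries.mk (q n) ^ (n + 1) = PowerSeries.mk p := fun n => by
    rw [← mk_nconv, hqp]
  have hq0 : Tendsto (fun n => q n 0) atTop (𝓝 1) := by
    have e : ∀ n, q n 0 = p 0 ^ (((n + 1 : ℕ) : ℝ)⁻¹) := fun n => by
      rw [← hqp n, nconv_zero_right, Real.pow_rpow_inv_natCast ((hq n).1 0) n.succ_ne_zero]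
    simp only [e]
    have : Tendsto (fun n : ℕ => ((n + 1 : ℕ) : ℝ)⁻¹) atTop (𝓝 0) :=
      (tendsto_inv_atTop_nhds_zero_nat (𝕜 := ℝ)).comp (tendsto_add_atTop_nat 1)
    simpa [Function.comp_def] using (Real.continuousAt_const_rpow h0.ne').tendsto.comp this
  have hqj : ∀ j, Tendsto (fun n => q n j) atTop (𝓝 (if j = 0 then 1 else 0)) := fun j => by
    split_ifs with hj
    · rwa [hj]
    · refine squeeze_zero (fun n => (hq n).1 j) (fun n => (hq n).le_one_sub hj) ?_
      simpa using hq0.const_sub 1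
  have hlim : Tendsto (fun n => coeff m (L * PowerSeries.mk (q n))) atTop (𝓝 (coeff m L)) := by
    have : coeff m L = ∑ x ∈ Finset.HasAntidiagonal.antidiagonal m, coeff x.1 L * (if x.2 = 0 then 1 else 0) := by
      conv_lhs => rw [← mul_one L, coeff_mul]
      simp only [coeff_one]
    rw [this]
    simp only [coeff_mul, coeff_mk]
    exact tendsto_finsetSum _ fun x _ => (hqj x.2).const_mul _
  refine ge_of_tendsto' hlim fun n => ?_
  have hne : PowerSeries.mk (q n) ^ n ≠ 0 := by
    refine pow_ne_zero _ fun hz => h0.ne' ?_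
    have := congrArg (coeff 0) (hpow n)
    simpa [hz] using this.symm
  have key : L * PowerSeries.mk (q n) =
      ((n + 1 : ℕ) : ℝ⟦X⟧) * derivative ℝ (PowerSeries.mk (q n)) := by
    refine mul_left_cancel₀ hne ?_
    have := hL
    rw [← hpow n, Derivation.leibniz_pow] at this
    simp only [Nat.add_sub_cancel, smul_eq_mul, nsmul_eq_mul] at this
    rw [pow_succ] at this
    linear_combination this
  rw [key, ← nsmul_eq_mul, map_nsmul, nsmul_eq_mul, coeff_derivative, coeff_mk]
  have := (hq n).1 (m + 1)
  positivity

/-- A power series with logarithmic derivative that of `exp G`, where `G(0) = 0`, is `P(0) exp G`. -/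
lemma coeff_eq_sum_of_derivative_eq {P G : ℝ⟦X⟧} (hG : constantCoeff G = 0)
    (hP : derivative ℝ P = derivative ℝ G * P) (m : ℕ) :
    coeff m P = constantCoeff P *
      ∑ k ∈ Finset.range (m + 1), coeff m (G ^ k) / (k.factorial : ℝ) := by
  have hlt : ∀ {k i : ℕ}, i < k → coeff i (G ^ k) = 0 := fun {k i} h =>
    X_pow_dvd_iff.1 (pow_dvd_pow_of_dvd (X_dvd_iff.2 hG) k) i h
  induction m using Nat.strong_induction_on with
  | _ m ih =>
    cases m with
    | zero => simp
    | succ m =>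
      have h1 : (m + 1 : ℝ) ≠ 0 := by positivity
      refine mul_right_cancel₀ h1 ?_
      rw [← coeff_derivative, hP, coeff_mul, mul_assoc, Finset.sum_mul,
        Finset.sum_range_succ' _ (m + 1)]
      have hk : ∀ k : ℕ, coeff (m + 1) (G ^ (k + 1)) / ((k + 1).factorial : ℝ) * (m + 1) =
          coeff m (derivative ℝ G * G ^ k) / (k.factorial : ℝ) := fun k => by
        rw [div_mul_eq_mul_div, ← coeff_derivative, Derivation.leibniz_pow, Nat.add_sub_cancel,
          map_nsmul, smul_eq_mul, nsmul_eq_mul, Nat.factorial_succ, mul_comm (G ^ k)]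
        push_cast
        field_simp
      simp only [hk, coeff_mul (R := ℝ) m, Finset.sum_div]
      rw [Finset.sum_comm]
      simp only [pow_zero, coeff_one, Nat.succ_ne_zero, if_false, zero_div, zero_mul, add_zero]
      rw [Finset.mul_sum]
      refine Finset.sum_congr rfl fun x hx => ?_
      have hx2 : x.2 ≤ m := by
        have := Finset.HasAntidiagonal.mem_antidiagonal.1 hx
        omega
      rw [ih x.2 (by omega), mul_left_comm, Finset.mul_sum]
      congr 1
      simp only [mul_div_assoc]
      refine Finset.sum_subset (Finset.range_mono (by omega)) fun k _ hk => ?_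
      rw [hlt (by simpa using hk)]
      simp

lemma exists_exponent_of_infinitelyDivisible {p : ℕ → ℝ} (hp : IsPMF p)
    (h : ∀ n : ℕ, 1 ≤ n → ∃ q : ℕ → ℝ, IsPMF q ∧ nconv q n = p) :
    ∃ g : ℕ → ℝ, (∀ j, 0 ≤ g j) ∧
      ∀ m, HasSum (fun k : ℕ => p 0 * (nconv g k m / (k.factorial : ℝ))) (p m) := by
  have h0 := pos_zero_of_infinitelyDivisible hp h
  have hc : constantCoeff (PowerSeries.mk p) ≠ 0 := by simpa using h0.ne'
  set L : ℝ⟦X⟧ := derivative ℝ (PowerSeries.mk p) * (PowerSeries.mk p)⁻¹ with hLdef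
  have hL : L * PowerSeries.mk p = derivative ℝ (PowerSeries.mk p) := by
    rw [hLdef, mul_assoc, PowerSeries.inv_mul_cancel _ hc, mul_one]
  let g : ℕ → ℝ := fun j => if j = 0 then 0 else coeff (j - 1) L / j
  have hg0 : g 0 = 0 := by simp [g]
  have hg : derivative ℝ (PowerSeries.mk g) = L := by
    ext m
    rw [coeff_derivative, coeff_mk]
    simp only [g, Nat.succ_ne_zero, if_false, Nat.add_sub_cancel]
    push_cast
    field_simp
  refine ⟨g, fun j => ?_, fun m => ?_⟩
  · simp only [g]
    split_ifs
    · exact le_rfl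
    · exact div_nonneg (coeff_logDeriv_nonneg h0 h hL _) (Nat.cast_nonneg _)
  · have hm := coeff_eq_sum_of_derivative_eq (P := PowerSeries.mk p) (G := PowerSeries.mk g)
      (by simpa using hg0) (by rw [hg, hL]) m
    simp only [← nconv_eq_coeff, coeff_mk, constantCoeff_mk, Finset.mul_sum] at hm
    rw [hm]
    refine hasSum_sum_of_ne_finset_zero fun k hk => ?_
    rw [nconv_eq_zero_of_lt hg0 (by simpa using hk)]
    simp

/-- A pmf on ℕ is infinitely divisible with integer-valued components iff it is a compound
Poisson of a nonnegative integer valued random variable: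
p(m) = e^{-λ} ∑_{k≥0} (λ^k/k!) r^{*k}(m) for some λ ≥ 0 and pmf r. -/
theorem stmt_7 (p : ℕ → ℝ) (hp : IsPMF p) :
    (∀ n : ℕ, 1 ≤ n → ∃ q : ℕ → ℝ, IsPMF q ∧ nconv q n = p) ↔
    (∃ l : ℝ, 0 ≤ l ∧ ∃ r : ℕ → ℝ, IsPMF r ∧
      ∀ m : ℕ, HasSum (fun k : ℕ => Real.exp (-l) * (l ^ k / (k.factorial : ℝ)) * nconv r k m)
        (p m)) := by
  constructor
  · intro h
    have h0 := pos_zero_of_infinitelyDivisible hp h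
    obtain ⟨g, hg, hpg⟩ := exists_exponent_of_infinitelyDivisible hp h
    have hgs : Summable g := by
      have hle : ∀ m, p 0 * g m ≤ p m := fun m => by
        have := le_hasSum (hpg m) 1 fun k _ =>
          mul_nonneg h0.le (div_nonneg (nconv_nonneg hg _ _) (Nat.cast_nonneg _))
        simpa [nconv_eq_coeff] using this
      exact (summable_mul_left_iff h0.ne').1
        (hp.2.summable.of_nonneg_of_le (fun m => mul_nonneg h0.le (hg m)) hle)
    obtain ⟨l, hl⟩ := hgs
    have hl0 : 0 ≤ l := hl.nonneg hg
    have hp0 : p 0 = Real.exp (-l) := by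
      have h1 := (hasSum_exp_nconv hg hl zero_le_one).mul_left (p 0)
      rw [← (Equiv.prodComm ℕ ℕ).hasSum_iff] at h1
      have h2 := h1.prod_fiberwise (g := p) fun m => by
        simpa only [Function.comp_apply, Equiv.prodComm_apply, Prod.swap_prod_mk, one_pow,
          div_mul_eq_mul_div, one_mul] using hpg m
      have h3 := h2.unique hp.2
      rw [one_mul] at h3
      rw [Real.exp_neg]
      exact eq_inv_of_mul_eq_one_left h3
    obtain ⟨r, hr, hgr⟩ : ∃ r, IsPMF r ∧ g = fun j => l * r j := by
      rcases hl0.eq_or_lt with rfl | hlpos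
      · refine ⟨nconv g 0, ⟨nconv_nonneg hg 0, by simpa using hasSum_nconv hg hl 0⟩, ?_⟩
        simpa [funext_iff] using (hasSum_zero_iff_of_nonneg hg).1 hl
      · refine ⟨fun j => l⁻¹ * g j, ⟨fun j => mul_nonneg (inv_nonneg.2 hl0) (hg j), ?_⟩, ?_⟩
        · simpa [hlpos.ne'] using hl.mul_left l⁻¹
        · ext j
          field_simp
    refine ⟨l, hl0, r, hr, fun m => ?_⟩
    convert hpg m using 2 with k
    rw [hgr, nconv_const_mul, hp0]
    ring
  · rintro ⟨l, hl, r, hr, h⟩ n hn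
    have hln : 0 ≤ l / n := by positivity
    refine ⟨compoundPoisson r (l / n), isPMF_compoundPoisson hr hln, ?_⟩
    have hn0 : (n : ℝ) ≠ 0 := by positivity
    rw [nconv_compoundPoisson hr hln, mul_div_cancel₀ l hn0]
    exact funext fun m => (h m).tsum_eq
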